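/- arXiv:1904.03134 — 2 statements merged into one kernel-verified Lean document; each statement's English description precedes it below -/
import Mathlib

section
/- Let D, d ≥ 1 be integers, p ∈ (1,∞) and κ ≥ 0, and let F(ξ) = (κ + |ξ|)^{(p−2)/2} ξ for ξ ∈ ℝ^{D×d}. Then there exist constants c, C > 0 depending only on p such that for all ξ, η ∈ ℝ^{D×d}: c·(κ + |ξ| + |η − ξ|)^{p−2} |η − ξ|² ≤ |F(η) − F(ξ)|² ≤ C·(κ + |ξ| + |η − ξ|)^{p−2} |η − ξ|². -/
open Real

/-- The nonlinear function `F(ξ) = (κ + |ξ|)^((p-2)/2) ξ` on matrices `ℝ^{D×d}`,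
identified with `EuclideanSpace ℝ (Fin D × Fin d)` (Frobenius norm). -/
noncomputable def Fnl (D d : ℕ) (p κ : ℝ)
    (ξ : EuclideanSpace ℝ (Fin D × Fin d)) : EuclideanSpace ℝ (Fin D × Fin d) :=
  ((κ + ‖ξ‖) ^ ((p - 2) / 2)) • ξ

lemma ratio_aux (s k u v : ℝ) (hu : 0 < u) (huv : u ≤ v) (hk : v ≤ k * u) :
    v ^ s ≤ k ^ |s| * u ^ s ∧ u ^ s ≤ k ^ |s| * v ^ s := by
  have hv : 0 < v := lt_of_lt_of_le hu huv
  have hw1 : 1 ≤ v / u := by rwa [one_le_div hu]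
  have hwk : v / u ≤ k := by rwa [div_le_iff₀ hu]
  have hw0 : 0 < v / u := by positivity
  have h1 : (v / u) ^ |s| ≤ k ^ |s| := rpow_le_rpow hw0.le hwk (abs_nonneg s)
  have h2 : (v / u) ^ s ≤ k ^ |s| :=
    (rpow_le_rpow_of_exponent_le hw1 (le_abs_self s)).trans h1
  have h3 : (v / u) ^ (-s) ≤ k ^ |s| :=
    (rpow_le_rpow_of_exponent_le hw1 (neg_le_abs s)).trans h1
  have hus := rpow_pos_of_pos hu s
  have hvs := rpow_pos_of_pos hv s
  rw [div_rpow hv.le hu.le] at h2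
  rw [rpow_neg hw0.le, div_rpow hv.le hu.le, inv_div] at h3
  exact ⟨(div_le_iff₀ hus).1 h2, (div_le_iff₀ hvs).1 h3⟩

lemma scal_lower (q κ a b : ℝ) (hq : -(1/2) < q) (hκ : 0 ≤ κ) (ha : 0 ≤ a) (hab : a ≤ b) :
    (1/2) * (κ + b) ^ q * (b - a) ≤ (κ + b) ^ q * b - (κ + a) ^ q * a := by
  have hyn : 0 ≤ (κ + b) ^ q := rpow_nonneg (by linarith) _
  rcases ha.eq_or_lt with rfl | ha'
  · nlinarith [mul_nonneg hyn hab]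
  have hx : 0 < κ + a := by linarith
  have hy : 0 < κ + b := by linarith
  have hxn : 0 ≤ (κ + a) ^ q := rpow_nonneg hx.le _
  have hd : 0 ≤ (κ + b) ^ q * (b - a) := mul_nonneg hyn (by linarith)
  rcases le_total 0 q with h0 | h0
  · have : (κ + a) ^ q ≤ (κ + b) ^ q := rpow_le_rpow hx.le (by linarith) h0
    nlinarith [mul_le_mul_of_nonneg_right this ha]
  · have hB : (1 + ((κ + b) / (κ + a) - 1)) ^ (-q) ≤ 1 + (-q) * ((κ + b) / (κ + a) - 1) := by
      apply rpow_one_add_le_one_add_mul_self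
      · have : 0 < (κ + b) / (κ + a) := by positivity
        linarith
      · linarith
      · linarith
    rw [add_sub_cancel, rpow_neg (by positivity), div_rpow hy.le hx.le, inv_div] at hB
    have hyp := rpow_pos_of_pos hy q
    rw [div_le_iff₀ hyp] at hB
    have hr : (κ + b) / (κ + a) - 1 = (b - a) / (κ + a) := by field_simp; ring
    rw [hr] at hB
    have h1 := mul_le_mul_of_nonneg_right hB ha
    have h2 : a / (κ + a) ≤ 1 := by rw [div_le_one hx]; linarith
    have h3 : (1 + -q * ((b - a) / (κ + a))) * (κ + b) ^ q * a
      = (κ + b) ^ q * a + (-q) * ((κ + b) ^ q * (b - a)) * (a / (κ + a)) := by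
      field_simp
    rw [h3] at h1
    have h4 : (-q) * ((κ + b) ^ q * (b - a)) * (a / (κ + a)) ≤
        (-q) * ((κ + b) ^ q * (b - a)) * 1 :=
      mul_le_mul_of_nonneg_left h2 (mul_nonneg (by linarith) hd)
    nlinarith [mul_le_mul_of_nonneg_right (show -q ≤ 1/2 by linarith) hd]

lemma scal_upper (q κ a b : ℝ) (hκ : 0 ≤ κ) (ha : 0 ≤ a) (hab : a ≤ b) :
    (κ + b) ^ q * b - (κ + a) ^ q * a ≤ (2 + |q|) * (κ + b) ^ q * (b - a) := by
  have hyn : 0 ≤ (κ + b) ^ q := rpow_nonneg (by linarith) _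
  have hqa := abs_nonneg q
  have hd : 0 ≤ (κ + b) ^ q * (b - a) := mul_nonneg hyn (by linarith)
  rcases ha.eq_or_lt with rfl | ha'
  · nlinarith [mul_nonneg hqa hd]
  have hx : 0 < κ + a := by linarith
  have hy : 0 < κ + b := by linarith
  rcases le_total q 0 with h0 | h0
  · have : (κ + b) ^ q ≤ (κ + a) ^ q := rpow_le_rpow_of_nonpos hx (by linarith) h0
    nlinarith [mul_le_mul_of_nonneg_right this ha, mul_nonneg hqa hd]
  · rw [abs_of_nonneg h0] at *
    have hyp := rpow_pos_of_pos hy q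
    have ht0 : 0 < (κ + a) / (κ + b) := by positivity
    have ht1 : (κ + a) / (κ + b) ≤ 1 := by rw [div_le_one hy]; linarith
    have hr : 1 - (κ + a) / (κ + b) = (b - a) / (κ + b) := by field_simp; ring
    have key : 1 - ((κ + a) / (κ + b)) ^ q ≤ (1 + q) * (1 - (κ + a) / (κ + b)) := by
      rcases le_total q 1 with h1 | h1
      · have := rpow_le_rpow_of_exponent_ge ht0 ht1 h1
        rw [rpow_one] at this
        nlinarith
      · have := one_add_mul_self_le_rpow_one_add (s := (κ + a) / (κ + b) - 1) (by linarith) h1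
        rw [add_sub_cancel] at this
        nlinarith
    rw [hr, div_rpow hx.le hy.le] at key
    have h1 := mul_le_mul_of_nonneg_right key (mul_nonneg hyp.le ha)
    have h2 : (1 - (κ + a) ^ q / (κ + b) ^ q) * ((κ + b) ^ q * a)
      = (κ + b) ^ q * a - (κ + a) ^ q * a := by field_simp
    have h3 : (1 + q) * ((b - a) / (κ + b)) * ((κ + b) ^ q * a) =
      (1 + q) * ((κ + b) ^ q * (b - a)) * (a / (κ + b)) := by ring
    have h4 : a / (κ + b) ≤ 1 := by rw [div_le_one hy]; linarith
    rw [h2, h3] at h1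
    have h5 := mul_le_mul_of_nonneg_left h4 (mul_nonneg (show 0 ≤ 1 + q by linarith) hd)
    nlinarith

set_option maxHeartbeats 1000000 in
lemma core_aux {E : Type*} [NormedAddCommGroup E] [InnerProductSpace ℝ E]
    (q κ : ℝ) (hq : -(1/2) < q) (hκ : 0 ≤ κ) (ξ η : E) (hab : ‖ξ‖ ≤ ‖η‖)
    (hy : 0 < κ + ‖η‖) :
    (1 / (64 * 2 ^ |q|)) * ((κ + ‖η‖) ^ q) ^ 2 * ‖η - ξ‖ ^ 2 ≤
      ‖(κ + ‖η‖) ^ q • η - (κ + ‖ξ‖) ^ q • ξ‖ ^ 2 ∧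
    ‖(κ + ‖η‖) ^ q • η - (κ + ‖ξ‖) ^ q • ξ‖ ^ 2 ≤
      ((4 + |q|) ^ 2 * 2 ^ |q|) * ((κ + ‖η‖) ^ q) ^ 2 * ‖η - ξ‖ ^ 2 := by
  have hlo := scal_lower q κ ‖ξ‖ ‖η‖ hq hκ (norm_nonneg _) hab
  have hup := scal_upper q κ ‖ξ‖ ‖η‖ hκ (norm_nonneg _) hab
  have hL : (1:ℝ) ≤ 2 ^ |q| := one_le_rpow (by norm_num) (abs_nonneg q)
  have hY : 0 < (κ + ‖η‖) ^ q := rpow_pos_of_pos hy q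
  have hX : 0 ≤ (κ + ‖ξ‖) ^ q := rpow_nonneg (by positivity) q
  have hR : (κ + ‖η‖) / 2 ≤ κ + ‖ξ‖ →
      (κ + ‖η‖) ^ q ≤ 2 ^ |q| * (κ + ‖ξ‖) ^ q ∧ (κ + ‖ξ‖) ^ q ≤ 2 ^ |q| * (κ + ‖η‖) ^ q :=
    fun h => ratio_aux q 2 _ _ (by linarith) (by linarith) (by linarith)
  have hN : ‖(κ + ‖η‖) ^ q • η - (κ + ‖ξ‖) ^ q • ξ‖ ^ 2 =
      ((κ + ‖η‖) ^ q * ‖η‖ - (κ + ‖ξ‖) ^ q * ‖ξ‖) ^ 2 +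
      2 * ((κ + ‖ξ‖) ^ q * (κ + ‖η‖) ^ q) * (‖ξ‖ * ‖η‖ - inner ℝ η ξ) := by
    rw [norm_sub_sq_real, norm_smul, norm_smul, real_inner_smul_left, real_inner_smul_right,
      norm_of_nonneg hX, norm_of_nonneg hY.le]
    ring
  have hD : ‖η - ξ‖ ^ 2 = (‖η‖ - ‖ξ‖) ^ 2 + 2 * (‖ξ‖ * ‖η‖ - inner ℝ η ξ) := by
    rw [norm_sub_sq_real]; ring
  have hI : 0 ≤ ‖ξ‖ * ‖η‖ - inner ℝ η ξ := by
    have := real_inner_le_norm η ξ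
    linarith [mul_comm ‖ξ‖ ‖η‖]
  have hI2 : ‖ξ‖ * ‖η‖ - inner ℝ η ξ ≤ 2 * (‖ξ‖ * ‖η‖) := by
    have := neg_le_of_abs_le (abs_real_inner_le_norm η ξ)
    linarith [mul_comm ‖ξ‖ ‖η‖]
  rw [hN, hD]
  have ha := norm_nonneg ξ
  have hqa := abs_nonneg q
  generalize (inner ℝ η ξ : ℝ) = i at *
  generalize ‖ξ‖ = a at *
  generalize ‖η‖ = b at *
  generalize (κ + b) ^ q = Y at *
  generalize (κ + a) ^ q = X at *
  generalize (2:ℝ) ^ |q| = L at *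
  generalize |q| = r at *
  have hd0 : 0 ≤ b - a := by linarith
  have hYd : 0 ≤ Y * (b - a) := mul_nonneg hY.le hd0
  have hlo2 : (1/4) * (Y ^ 2 * (b - a) ^ 2) ≤ (Y * b - X * a) ^ 2 := by
    have := pow_le_pow_left₀ (by linarith) hlo 2
    linarith [this, show (1 / 2 * Y * (b - a)) ^ 2 = (1/4) * (Y ^ 2 * (b - a) ^ 2) by ring]
  have hup2 : (Y * b - X * a) ^ 2 ≤ (2 + r) ^ 2 * (Y ^ 2 * (b - a) ^ 2) := by
    have := pow_le_pow_left₀ (by linarith) hup 2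
    linarith [this, show ((2 + r) * Y * (b - a)) ^ 2 = (2 + r) ^ 2 * (Y ^ 2 * (b - a) ^ 2) by ring]
  have hm : 1 / (64 * L) ≤ 1 / 64 := by
    apply one_div_le_one_div_of_le <;> linarith
  have hm0 : 0 < 1 / (64 * L) := by positivity
  have hMr : 16 ≤ (4 + r) ^ 2 := by nlinarith
  have hM1 : (4 + r) ^ 2 ≤ (4 + r) ^ 2 * L := le_mul_of_one_le_right (by positivity) hL
  have hM2 : L ≤ (4 + r) ^ 2 * L := le_mul_of_one_le_left (by linarith) (by linarith)
  have hr2 : (2 + r) ^ 2 ≤ (4 + r) ^ 2 := by nlinarith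
  have hP : 0 ≤ Y ^ 2 * (b - a) ^ 2 := by positivity
  have hQ : 0 ≤ Y * (a * b - i) := mul_nonneg hY.le hI
  have hQ2 : 0 ≤ Y ^ 2 * (a * b - i) := mul_nonneg (by positivity) hI
  rcases le_or_gt ((κ + b) / 2) (κ + a) with hc | hc
  · obtain ⟨h1, h2⟩ := hR hc
    constructor
    · have e1 : 1 / (64 * L) * (Y ^ 2 * (b - a) ^ 2) ≤ 1/64 * (Y ^ 2 * (b - a) ^ 2) :=
        mul_le_mul_of_nonneg_right hm hP
      have e2 : 1 / (64 * L) * Y ≤ X := by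
        rw [div_mul_eq_mul_div, div_le_iff₀ (by positivity)]
        nlinarith [mul_nonneg hX (show 0 ≤ L by linarith)]
      have e3 := mul_le_mul_of_nonneg_right e2 hQ
      linarith
    · have e1 : (2 + r) ^ 2 * (Y ^ 2 * (b - a) ^ 2) ≤ ((4 + r) ^ 2 * L) * (Y ^ 2 * (b - a) ^ 2) :=
        mul_le_mul_of_nonneg_right (hr2.trans hM1) hP
      have e3 := mul_le_mul_of_nonneg_right h2 hQ
      have e4 := mul_le_mul_of_nonneg_right hM2 hQ2
      linarith
  · have hb : 0 ≤ b := by linarith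
    have hz : κ + b ≤ 2 * (b - a) := by linarith
    -- size of the difference
    have hS : (b - a) ^ 2 + 2 * (a * b - i) ≤ 16 * (b - a) ^ 2 := by
      have : (b + a) ^ 2 ≤ (4 * (b - a)) ^ 2 := pow_le_pow_left₀ (by linarith) (by linarith) 2
      nlinarith
    have hT : (Y * b - X * a) ^ 2 + 2 * (X * Y) * (a * b - i) ≤ 16 * (Y ^ 2 * (b - a) ^ 2) := by
      have hXa : X * a ≤ Y * b := by nlinarith
      have hXa0 : 0 ≤ X * a := mul_nonneg hX ha
      have h1 : (X * Y) * (a * b - i) ≤ (X * Y) * (2 * (a * b)) :=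
        mul_le_mul_of_nonneg_left hI2 (mul_nonneg hX hY.le)
      have h2 : Y * b ≤ Y * (2 * (b - a)) := mul_le_mul_of_nonneg_left (by linarith) hY.le
      have h3 : (Y * b + X * a) ^ 2 ≤ (4 * (Y * (b - a))) ^ 2 :=
        pow_le_pow_left₀ (by positivity) (by linarith) 2
      nlinarith
    have hE0 : 0 ≤ Y ^ 2 * ((b - a) ^ 2 + 2 * (a * b - i)) := by positivity
    have hE : Y ^ 2 * ((b - a) ^ 2 + 2 * (a * b - i)) ≤ Y ^ 2 * (16 * (b - a) ^ 2) :=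
      mul_le_mul_of_nonneg_left hS (by positivity)
    constructor
    · have := mul_le_mul_of_nonneg_right hm hE0
      have h5 : 0 ≤ (X * Y) * (a * b - i) := mul_nonneg (mul_nonneg hX hY.le) hI
      linarith
    · have := mul_le_mul_of_nonneg_right (hMr.trans hM1) hE0
      linarith

/-- Symmetrised version. -/
lemma core_full {E : Type*} [NormedAddCommGroup E] [InnerProductSpace ℝ E]
    (q κ : ℝ) (hq : -(1/2) < q) (hκ : 0 ≤ κ) (ξ η : E) (hne : η ≠ ξ) :
    ∃ y : ℝ, 0 < y ∧ y ≤ κ + ‖ξ‖ + ‖η - ξ‖ ∧ κ + ‖ξ‖ + ‖η - ξ‖ ≤ 3 * y ∧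
    (1 / (64 * 2 ^ |q|)) * (y ^ q) ^ 2 * ‖η - ξ‖ ^ 2 ≤
      ‖(κ + ‖η‖) ^ q • η - (κ + ‖ξ‖) ^ q • ξ‖ ^ 2 ∧
    ‖(κ + ‖η‖) ^ q • η - (κ + ‖ξ‖) ^ q • ξ‖ ^ 2 ≤
      ((4 + |q|) ^ 2 * 2 ^ |q|) * (y ^ q) ^ 2 * ‖η - ξ‖ ^ 2 := by
  have h0 : 0 < ‖η - ξ‖ := norm_pos_iff.2 (sub_ne_zero.2 hne)
  have h1 : ‖η - ξ‖ ≤ ‖η‖ + ‖ξ‖ := norm_sub_le _ _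
  have h2 : ‖η‖ ≤ ‖ξ‖ + ‖η - ξ‖ := norm_le_insert' η ξ
  rcases le_total ‖ξ‖ ‖η‖ with h | h
  · have hy : 0 < κ + ‖η‖ := by linarith
    exact ⟨κ + ‖η‖, hy, by linarith, by linarith, core_aux q κ hq hκ ξ η h hy⟩
  · have hy : 0 < κ + ‖ξ‖ := by linarith
    have := core_aux q κ hq hκ η ξ h hy
    rw [norm_sub_rev ξ η, norm_sub_rev (_ • ξ)] at this
    exact ⟨κ + ‖ξ‖, hy, by linarith, by linarith, this⟩

/-- There are constants `c, C > 0` depending only on `p` such that for all `D, d ≥ 1`,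
`κ ≥ 0` and all matrices `ξ, η`:
`c (κ+|ξ|+|η-ξ|)^{p-2} |η-ξ|² ≤ |F(η)-F(ξ)|² ≤ C (κ+|ξ|+|η-ξ|)^{p-2} |η-ξ|²`. -/
theorem F_shift_equiv (p : ℝ) (hp : 1 < p) :
    ∃ c C : ℝ, 0 < c ∧ 0 < C ∧
      ∀ (D d : ℕ), 1 ≤ D → 1 ≤ d → ∀ κ : ℝ, 0 ≤ κ →
        ∀ ξ η : EuclideanSpace ℝ (Fin D × Fin d),
          c * (κ + ‖ξ‖ + ‖η - ξ‖) ^ (p - 2) * ‖η - ξ‖ ^ 2 ≤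
              ‖Fnl D d p κ η - Fnl D d p κ ξ‖ ^ 2 ∧
          ‖Fnl D d p κ η - Fnl D d p κ ξ‖ ^ 2 ≤
              C * (κ + ‖ξ‖ + ‖η - ξ‖) ^ (p - 2) * ‖η - ξ‖ ^ 2 := by
  have hK : (0:ℝ) < 3 ^ |p - 2| := by positivity
  refine ⟨1 / (64 * 2 ^ |(p - 2) / 2|) / 3 ^ |p - 2|,
    (4 + |(p - 2) / 2|) ^ 2 * 2 ^ |(p - 2) / 2| * 3 ^ |p - 2|, by positivity, by positivity, ?_⟩
  intro D d _ _ κ hκ ξ η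
  rcases eq_or_ne η ξ with rfl | hne
  · simp
  obtain ⟨y, hy, hy1, hy3, hlo, hup⟩ :=
    core_full ((p - 2) / 2) κ (by linarith) hκ ξ η hne
  have hyq : (y ^ ((p - 2) / 2)) ^ 2 = y ^ (p - 2) := by
    rw [← rpow_natCast, ← rpow_mul hy.le]
    congr 1
    push_cast
    ring
  rw [hyq] at hlo hup
  obtain ⟨r1, r2⟩ := ratio_aux (p - 2) 3 y _ hy hy1 hy3
  unfold Fnl
  constructor
  · refine le_trans ?_ hlo
    refine mul_le_mul_of_nonneg_right ?_ (by positivity)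
    rw [div_mul_eq_mul_div, div_le_iff₀ hK, mul_assoc, mul_comm (y ^ (p - 2))]
    exact mul_le_mul_of_nonneg_left r1 (by positivity)
  · refine le_trans hup ?_
    refine mul_le_mul_of_nonneg_right ?_ (by positivity)
    rw [mul_assoc _ (3 ^ |p - 2|)]
    exact mul_le_mul_of_nonneg_left r2 (by positivity)
end

section
/- Let 0 < a ≤ 1, let θ : [0,1] → ℝ be continuous with θ(s) ≠ 0 for all s, differentiable with bounded derivative θ', and let η be a continuous nonvanishing real-valued function of (τ̃, τ) on the triangle {0 ≤ τ̃ ≤ τ ≤ 1} whose partial derivative ∂η/∂τ exists and is bounded. Set G(τ) = θ(τ) τ^a and, for fixed τ̃, G̃(τ) = (G(τ) − G(τ̃)) η(τ, τ̃). Then there exist C > 0 and τ₀ ∈ (0,1] such that for all 0 < τ̃ < τ ≤ τ₀: G̃(τ) ≠ 0 and |τ·∂_τG̃(τ)/G̃(τ) − a·β| ≤ C τ β, where β = β_{τ,τ̃}(a) := τ^a/(τ^a − τ̃^a) is the bias factor and ∂_τ denotes differentiation in τ with τ̃ fixed. (Equivalently, d(log|G̃|)/d(log τ) = (a + O(τ))·β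 uniformly in 0 < τ̃ < τ ≤ τ₀.) -/
open Real Set

lemma aux_bern (a x y : ℝ) (ha : 0 < a) (ha1 : a ≤ 1) (hy : 0 < y) (hxy : y < x) :
    a * x ^ a * (x - y) ≤ x * (x ^ a - y ^ a) := by
  have hx : 0 < x := hy.trans hxy
  have h1 : (1 + (y / x - 1)) ^ a ≤ 1 + a * (y / x - 1) := by
    apply rpow_one_add_le_one_add_mul_self _ ha.le ha1
    have : 0 < y / x := by positivity
    linarith
  have h2 : 1 + (y / x - 1) = y / x := by ring
  rw [h2, Real.div_rpow hy.le hx.le] at h1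
  have hxa : 0 < x ^ a := Real.rpow_pos_of_pos hx a
  rw [div_le_iff₀ hxa] at h1
  have h3 : x * ((1 + a * (y / x - 1)) * x ^ a) = x * x ^ a - a * x ^ a * (x - y) := by
    field_simp
    ring
  have := mul_le_mul_of_nonneg_left h1 hx.le
  linarith

lemma aux_alg (a x X Y D p q p' e e' m n K L : ℝ) (ha : 0 < a) (hx : 0 < x)
    (hX : 0 < X) (hY : 0 < Y) (hD : D = X - Y) (hD0 : 0 < D)
    (hm : 0 < m) (hn : 0 < n) (hp : m ≤ |p|) (he : n ≤ |e|) (hp' : |p'| ≤ K) (he' : |e'| ≤ L)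
    (hpq : |p - q| * Y * a ≤ K * (x * D)) (hsmall : 2 * K * x ≤ a * m) :
    (p * X - q * Y) * e ≠ 0 ∧
    |x * ((p' * X + p * (a * (X / x))) * e + (p * X - q * Y) * e') / ((p * X - q * Y) * e)
      - a * (X / D)| ≤ (4 * K / m + L / n + 1) * x * (X / D) := by
  have hK : 0 ≤ K := (abs_nonneg _).trans hp'
  have hL : 0 ≤ L := (abs_nonneg _).trans he'
  have hN : p * X - q * Y = p * D + (p - q) * Y := by rw [hD]; ring
  have hN2 : m * D / 2 ≤ |p * X - q * Y| := by
    have h1 : |p| * D - |p - q| * Y ≤ |p * X - q * Y| := by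
      rw [hN]
      have := abs_sub_abs_le_abs_sub (p * D) (-((p - q) * Y))
      rw [abs_neg, abs_mul, abs_mul, abs_of_pos hD0, abs_of_pos hY, sub_neg_eq_add] at this
      exact this
    have h2 : |p - q| * Y ≤ m * D / 2 := by
      have : a * (|p - q| * Y) ≤ a * (m * D / 2) := by nlinarith
      exact le_of_mul_le_mul_left this ha
    nlinarith
  have hmD : 0 < m * D / 2 := by positivity
  have hNpos : 0 < |p * X - q * Y| := lt_of_lt_of_le hmD hN2
  have hN0 : p * X - q * Y ≠ 0 := abs_pos.mp hNpos
  have hepos : 0 < |e| := lt_of_lt_of_le hn he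
  have he0 : e ≠ 0 := abs_pos.mp hepos
  refine ⟨mul_ne_zero hN0 he0, ?_⟩
  set N := p * X - q * Y with hNdef
  have hpD : p * D - N = -((p - q) * Y) := by rw [hN]; ring
  have hdec : x * ((p' * X + p * (a * (X / x))) * e + N * e') / (N * e) - a * (X / D)
      = x * p' * X / N + a * X * (p * D - N) / (N * D) + x * e' / e := by
    field_simp
    ring
  rw [hdec, hpD]
  have t1 : |x * p' * X / N| ≤ (2 * K / m) * x * (X / D) := by
    rw [abs_div, abs_mul, abs_mul, abs_of_pos hx, abs_of_pos hX]
    calc x * |p'| * X / |N| ≤ x * K * X / (m * D / 2) := by gcongr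
      _ = _ := by field_simp
  have t2 : |a * X * -((p - q) * Y) / (N * D)| ≤ (2 * K / m) * x * (X / D) := by
    rw [abs_div, abs_mul, abs_mul, abs_neg, abs_mul, abs_mul, abs_of_pos ha, abs_of_pos hX,
      abs_of_pos hY, abs_of_pos hD0]
    calc a * X * (|p - q| * Y) / (|N| * D) = X * (|p - q| * Y * a) / (|N| * D) := by ring
      _ ≤ X * (K * (x * D)) / ((m * D / 2) * D) := by gcongr
      _ = _ := by field_simp
  have hβ : 1 ≤ X / D := by rw [one_le_div hD0]; linarith
  have t3 : |x * e' / e| ≤ (L / n) * x * (X / D) := by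
    rw [abs_div, abs_mul, abs_of_pos hx]
    calc x * |e'| / |e| ≤ x * L / n := by gcongr
      _ = (L / n) * x * 1 := by ring
      _ ≤ _ := by gcongr
  have t4 : 0 ≤ x * (X / D) := by positivity
  refine (abs_add_three _ _ _).trans ?_
  have : (4 * K / m + L / n + 1) * x * (X / D) = (2 * K / m) * x * (X / D)
    + (2 * K / m) * x * (X / D) + (L / n) * x * (X / D) + x * (X / D) := by ring
  linarith

/-- Lemma 4.1 (biased estimator). Let `G(τ) = θ(τ) τ^a` and, for fixed `τ̃`,
`G̃(τ) = (G(τ) - G(τ̃)) η(τ, τ̃)`, where `θ` is continuous and nonvanishing on `[0,1]`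
with bounded derivative, and `η` is continuous and nonvanishing on the triangle
`{0 ≤ τ̃ ≤ τ ≤ 1}` with bounded partial derivative in `τ`. Then, for sufficiently
small `0 < τ̃ < τ`, `G̃(τ) ≠ 0` and the logarithmic derivative of `G̃` equals
`(a + O(τ)) β` where `β = τ^a/(τ^a - τ̃^a)` is the bias factor. -/
theorem log_deriv_bias (a : ℝ) (ha : 0 < a) (ha1 : a ≤ 1)
    (θ : ℝ → ℝ) (hθc : ContinuousOn θ (Icc 0 1))
    (hθne : ∀ s ∈ Icc (0 : ℝ) 1, θ s ≠ 0)
    (hθd : ∀ t ∈ Ioo (0 : ℝ) 1, DifferentiableAt ℝ θ t)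
    (Kθ : ℝ) (hθ' : ∀ t ∈ Ioo (0 : ℝ) 1, |deriv θ t| ≤ Kθ)
    (η : ℝ → ℝ → ℝ)
    (hηc : ContinuousOn (fun q : ℝ × ℝ => η q.1 q.2)
      {q : ℝ × ℝ | 0 ≤ q.2 ∧ q.2 ≤ q.1 ∧ q.1 ≤ 1})
    (hηne : ∀ τt τ : ℝ, 0 ≤ τt → τt ≤ τ → τ ≤ 1 → η τ τt ≠ 0)
    (hηd : ∀ τt τ : ℝ, 0 ≤ τt → τt ≤ τ → τ ≤ 1 → DifferentiableAt ℝ (fun t => η t τt) τ)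
    (Kη : ℝ) (hη' : ∀ τt τ : ℝ, 0 ≤ τt → τt ≤ τ → τ ≤ 1 →
      |deriv (fun t => η t τt) τ| ≤ Kη) :
    ∃ C : ℝ, 0 < C ∧ ∃ τ₀ ∈ Ioc (0 : ℝ) 1, ∀ τt τ : ℝ, 0 < τt → τt < τ → τ ≤ τ₀ →
      (θ τ * τ ^ a - θ τt * τt ^ a) * η τ τt ≠ 0 ∧
      |τ * deriv (fun t : ℝ => (θ t * t ^ a - θ τt * τt ^ a) * η t τt) τ /
            ((θ τ * τ ^ a - θ τt * τt ^ a) * η τ τt) -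
          a * (τ ^ a / (τ ^ a - τt ^ a))| ≤
        C * τ * (τ ^ a / (τ ^ a - τt ^ a)) := by
  obtain ⟨s0, hs0, hmin⟩ := isCompact_Icc.exists_isMinOn (nonempty_Icc.mpr (zero_le_one' ℝ)) hθc.abs
  have hTc : IsCompact {q : ℝ × ℝ | 0 ≤ q.2 ∧ q.2 ≤ q.1 ∧ q.1 ≤ 1} := by
    apply (isCompact_Icc (a := ((0 : ℝ), (0 : ℝ))) (b := ((1 : ℝ), (1 : ℝ)))).of_isClosed_subset
    · exact (isClosed_le continuous_const continuous_snd).inter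
        ((isClosed_le continuous_snd continuous_fst).inter
          (isClosed_le continuous_fst continuous_const))
    · rintro ⟨u, v⟩ ⟨h1, h2, h3⟩
      simp only at h1 h2 h3
      exact ⟨⟨h1.trans h2, h1⟩, ⟨h3, h2.trans h3⟩⟩
  obtain ⟨q0, hq0, hqmin⟩ := hTc.exists_isMinOn ⟨((0 : ℝ), (0 : ℝ)), by simp⟩ hηc.abs
  have hm : 0 < |θ s0| := abs_pos.mpr (hθne s0 hs0)
  have hn : 0 < |η q0.1 q0.2| := abs_pos.mpr (hηne q0.2 q0.1 hq0.1 hq0.2.1 hq0.2.2)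
  have hK : 0 ≤ Kθ := (abs_nonneg _).trans (hθ' (1 / 2) (by constructor <;> norm_num))
  have hL : 0 ≤ Kη := (abs_nonneg _).trans (hη' 0 0 le_rfl le_rfl zero_le_one)
  refine ⟨4 * Kθ / |θ s0| + Kη / |η q0.1 q0.2| + 1, by positivity,
    min (1 / 2) (a * |θ s0| / (2 * (Kθ + 1))), ⟨by positivity, (min_le_left _ _).trans (by norm_num)⟩, ?_⟩
  intro y x hy hyx hx0
  have hx : 0 < x := hy.trans hyx
  have hx1 : x < 1 := lt_of_le_of_lt (hx0.trans (min_le_left _ _)) (by norm_num)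
  have hxs : x * (2 * (Kθ + 1)) ≤ a * |θ s0| := by
    have := hx0.trans (min_le_right _ _)
    rwa [le_div_iff₀ (by positivity)] at this
  have hXY : y ^ a < x ^ a := Real.rpow_lt_rpow hy.le hyx ha
  have hY : 0 < y ^ a := Real.rpow_pos_of_pos hy a
  have hX : 0 < x ^ a := Real.rpow_pos_of_pos hx a
  have hlip : |θ x - θ y| ≤ Kθ * (x - y) := by
    have := (convex_Ioo (0 : ℝ) 1).norm_image_sub_le_of_norm_deriv_le (f := θ) (C := Kθ)
      hθd hθ' (x := y) (y := x) ⟨hy, hyx.trans hx1⟩ ⟨hx, hx1⟩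
    rwa [Real.norm_eq_abs, Real.norm_eq_abs, abs_of_pos (sub_pos.mpr hyx)] at this
  have hpq : |θ x - θ y| * y ^ a * a ≤ Kθ * (x * (x ^ a - y ^ a)) := by
    have hb := aux_bern a x y ha ha1 hy hyx
    have hxy0 : 0 ≤ x - y := by linarith
    calc |θ x - θ y| * y ^ a * a ≤ (Kθ * (x - y)) * x ^ a * a := by gcongr
      _ = Kθ * (a * x ^ a * (x - y)) := by ring
      _ ≤ _ := by gcongr
  have hder : deriv (fun t : ℝ => (θ t * t ^ a - θ y * y ^ a) * η t y) x =
      (deriv θ x * x ^ a + θ x * (a * (x ^ a / x))) * η x y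
        + (θ x * x ^ a - θ y * y ^ a) * deriv (fun t => η t y) x := by
    have h1 := (hθd x ⟨hx, hx1⟩).hasDerivAt
    have h2 := Real.hasDerivAt_rpow_const (x := x) (p := a) (Or.inl hx.ne')
    have h3 := (hηd y x hy.le hyx.le hx1.le).hasDerivAt
    rw [Real.rpow_sub_one hx.ne'] at h2
    exact (((h1.mul h2).sub_const (θ y * y ^ a)).mul h3).deriv
  rw [hder]
  refine aux_alg a x (x ^ a) (y ^ a) _ (θ x) (θ y) _ (η x y) _ |θ s0| |η q0.1 q0.2| Kθ Kη ha hx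
    hX hY rfl (sub_pos.mpr hXY) hm hn (hmin ⟨hx.le, hx1.le⟩) ?_ (hθ' x ⟨hx, hx1⟩)
    (hη' y x hy.le hyx.le hx1.le) hpq (by nlinarith)
  exact hqmin (show (x, y) ∈ {q : ℝ × ℝ | 0 ≤ q.2 ∧ q.2 ≤ q.1 ∧ q.1 ≤ 1} from
    ⟨hy.le, hyx.le, hx1.le⟩)
end
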